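/- Let d ∈ {1,2}, let n = (n_x,n_z) ∈ ℝ^{3-d} × ℝ^d be a unit vector, let v be a complex-valued Schwartz function on ℝ^{3-d} × ℝ^d, and let q ∈ (0,1). Then there exists a constant C > 0 (depending on v, n, d and q but not on γ) such that for all γ ∈ (0,1]: ∫_{ℝ^{3-d} × ℝ^d} |m_γ(k_x,k_z) - m_0(k_x,k_z)| · |𝓕v(k_x,k_z)| dk_x dk_z ≤ C γ^q. -/

import Mathlib

open MeasureTheory Set
open scoped RealInnerProductSpace ENNReal

noncomputable section

/-- The confined directions `ℝ^{3-d}`. -/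
abbrev SpX (d : ℕ) : Type := EuclideanSpace ℝ (Fin (3 - d))

/-- The transversal directions `ℝ^d`. -/
abbrev SpZ (d : ℕ) : Type := EuclideanSpace ℝ (Fin d)

/-- The Fourier transform `𝓕u(k) = ∫ u(x) e^{-i k·x} dx` on `ℝ^{3-d} × ℝ^d`. -/
def FT (d : ℕ) (u : SpX d × SpZ d → ℂ) (k : SpX d × SpZ d) : ℂ :=
  ∫ x : SpX d × SpZ d,
    Complex.exp (-Complex.I * ((⟪k.1, x.1⟫ + ⟪k.2, x.2⟫ : ℝ) : ℂ)) * u x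

/-- The dipolar Fourier multiplier
`m_γ(k_x,k_z) = -1/3 + (γ k_x·n_x + k_z·n_z)² / (γ²|k_x|² + |k_z|²)`
(it takes the default value `-1/3` when the denominator vanishes). -/
def mdip (d : ℕ) (nx : SpX d) (nz : SpZ d) (γ : ℝ) (k : SpX d × SpZ d) : ℝ :=
  -1/3 + (γ * ⟪k.1, nx⟫ + ⟪k.2, nz⟫) ^ 2 / (γ ^ 2 * ‖k.1‖ ^ 2 + ‖k.2‖ ^ 2)

/-- The difference of the dipolar quotients at scales `γ` and `0`, bounded by a fractional power
of the ratio of the two frequencies. -/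
lemma abs_dipolar_quotient_sub_le {a b s t q : ℝ} (ha : |a| ≤ t) (hb : |b| ≤ s) (ht : 0 < t)
    (hq0 : 0 ≤ q) (hq1 : q ≤ 1) :
    |(b + a) ^ 2 / (s ^ 2 + t ^ 2) - a ^ 2 / t ^ 2| ≤ 4 * (s / t) ^ q := by
  have hs : 0 ≤ s := (abs_nonneg b).trans hb
  have ha2 : a ^ 2 ≤ t ^ 2 := sq_le_sq' (abs_le.mp ha).1 (abs_le.mp ha).2
  have hb2 : b ^ 2 ≤ s ^ 2 := sq_le_sq' (abs_le.mp hb).1 (abs_le.mp hb).2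
  have hst : 0 < s ^ 2 + t ^ 2 := by positivity
  rcases le_total t s with h | h
  · have h1 : 1 ≤ (s / t) ^ q := Real.one_le_rpow ((one_le_div ht).mpr h) hq0
    have h2 : (b + a) ^ 2 / (s ^ 2 + t ^ 2) ≤ 2 := by
      rw [div_le_iff₀ hst]
      nlinarith [sq_nonneg (b - a)]
    have h3 : 0 ≤ (b + a) ^ 2 / (s ^ 2 + t ^ 2) := by positivity
    have h4 : a ^ 2 / t ^ 2 ≤ 1 := (div_le_one (by positivity)).mpr ha2
    have h5 : 0 ≤ a ^ 2 / t ^ 2 := by positivity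
    rw [abs_le]
    constructor <;> linarith
  · have h1 : s / t ≤ (s / t) ^ q := by
      simpa using Real.rpow_le_rpow_of_exponent_ge' (div_nonneg hs ht.le)
        ((div_le_one ht).mpr h) hq0 hq1
    have hab : |a * b| ≤ t * s := by
      rw [abs_mul]
      exact mul_le_mul ha hb (abs_nonneg _) ht.le
    obtain ⟨hab1, hab2⟩ := abs_le.mp hab
    have hss : s ^ 2 ≤ t * s := by nlinarith
    have hquot : (b + a) ^ 2 / (s ^ 2 + t ^ 2) - a ^ 2 / t ^ 2 =
        (2 * (a * b) + b ^ 2 - a ^ 2 / t ^ 2 * s ^ 2) / (s ^ 2 + t ^ 2) := by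
      field_simp
      ring
    have h4 : a ^ 2 / t ^ 2 ≤ 1 := (div_le_one (by positivity)).mpr ha2
    have h5 : 0 ≤ a ^ 2 / t ^ 2 := by positivity
    have h6 : a ^ 2 / t ^ 2 * s ^ 2 ≤ t * s := by nlinarith [sq_nonneg s]
    have h7 : 0 ≤ a ^ 2 / t ^ 2 * s ^ 2 := by positivity
    have hnum : |2 * (a * b) + b ^ 2 - a ^ 2 / t ^ 2 * s ^ 2| ≤ 4 * (t * s) := by
      rw [abs_le]
      constructor <;> nlinarith [sq_nonneg b]
    calc |(b + a) ^ 2 / (s ^ 2 + t ^ 2) - a ^ 2 / t ^ 2|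
        = |2 * (a * b) + b ^ 2 - a ^ 2 / t ^ 2 * s ^ 2| / (s ^ 2 + t ^ 2) := by
          rw [hquot, abs_div, abs_of_pos hst]
      _ ≤ 4 * (t * s) / t ^ 2 := by
          gcongr
          nlinarith [sq_nonneg s]
      _ = 4 * (s / t) := by field_simp
      _ ≤ 4 * (s / t) ^ q := by gcongr

lemma abs_mdip_sub_mdip_zero_le {d : ℕ} {nx : SpX d} {nz : SpZ d}
    (hn : ‖nx‖ ^ 2 + ‖nz‖ ^ 2 = 1) {q : ℝ} (hq0 : 0 ≤ q) (hq1 : q ≤ 1) {γ : ℝ} (hγ : 0 ≤ γ)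
    {k : SpX d × SpZ d} (hk : k.2 ≠ 0) :
    |mdip d nx nz γ k - mdip d nx nz 0 k| ≤ 4 * γ ^ q * (‖k.1‖ ^ q * ‖k.2‖ ^ (-q)) := by
  have hx : ‖nx‖ ≤ 1 := by nlinarith [sq_nonneg ‖nz‖, norm_nonneg nx]
  have hz : ‖nz‖ ≤ 1 := by nlinarith [sq_nonneg ‖nx‖, norm_nonneg nz]
  have ha : |⟪k.2, nz⟫| ≤ ‖k.2‖ :=
    (abs_real_inner_le_norm _ _).trans (mul_le_of_le_one_right (norm_nonneg _) hz)
  have hb : |γ * ⟪k.1, nx⟫| ≤ γ * ‖k.1‖ := by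
    rw [abs_mul, abs_of_nonneg hγ]
    gcongr
    exact (abs_real_inner_le_norm _ _).trans (mul_le_of_le_one_right (norm_nonneg _) hx)
  have h := abs_dipolar_quotient_sub_le ha hb (norm_pos_iff.mpr hk) hq0 hq1
  rw [Real.div_rpow (by positivity) (by positivity), Real.mul_rpow hγ (by positivity)] at h
  rw [Real.rpow_neg (norm_nonneg _)]
  convert! h using 1
  · congr 1
    simp [mdip, mul_pow]
  · ring

/-- The weight `‖z‖ ^ (-q) * (1 + ‖z‖) ^ (-M)` is integrable if it is integrable at the origin
and at infinity. -/
lemma integrable_norm_rpow_mul_one_add_norm_rpow {E : Type*} [NormedAddCommGroup E]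
    [NormedSpace ℝ E] [FiniteDimensional ℝ E] [Nontrivial E] [MeasurableSpace E] [BorelSpace E]
    (μ : Measure E) [μ.IsAddHaarMeasure] {q M : ℝ} (hq : q < Module.finrank ℝ E) (hM0 : 0 ≤ M)
    (hM : Module.finrank ℝ E < q + M) :
    Integrable (fun z : E ↦ ‖z‖ ^ (-q) * (1 + ‖z‖) ^ (-M)) μ := by
  rw [integrable_fun_norm_addHaar μ (f := fun y : ℝ ↦ y ^ (-q) * (1 + y) ^ (-M))]
  set n := Module.finrank ℝ E
  have hn1 : 1 ≤ n := Module.finrank_pos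
  have hpow : ∀ y : ℝ, 0 < y → y ^ (n - 1) • (y ^ (-q) * (1 + y) ^ (-M)) =
      y ^ ((n : ℝ) - 1 - q) * (1 + y) ^ (-M) := by
    intro y hy
    rw [smul_eq_mul, ← mul_assoc, ← Real.rpow_natCast, ← Real.rpow_add hy, Nat.cast_sub hn1,
      Nat.cast_one, sub_eq_add_neg _ q]
  rw [← Ioc_union_Ioi_eq_Ioi zero_le_one, integrableOn_union]
  have hmeas : Measurable fun y : ℝ ↦ y ^ (n - 1) • (y ^ (-q) * (1 + y) ^ (-M)) := by fun_prop
  constructor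
  · have hint : IntegrableOn (fun y : ℝ ↦ y ^ ((n : ℝ) - 1 - q)) (Ioc 0 1) :=
      (intervalIntegrable_iff_integrableOn_Ioc_of_le zero_le_one).mp
        (intervalIntegral.intervalIntegrable_rpow' (by linarith))
    refine Integrable.mono' hint hmeas.aestronglyMeasurable
      ((ae_restrict_iff' measurableSet_Ioc).mpr (.of_forall fun y hy ↦ ?_))
    have hy0 : 0 < y := hy.1
    rw [hpow y hy0, Real.norm_of_nonneg (by positivity)]
    exact mul_le_of_le_one_right (by positivity)
      (Real.rpow_le_one_of_one_le_of_nonpos (by linarith) (neg_nonpos.mpr hM0))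
  · have hint : IntegrableOn (fun y : ℝ ↦ y ^ ((n : ℝ) - 1 - q - M)) (Ioi 1) :=
      integrableOn_Ioi_rpow_of_lt (by linarith) one_pos
    refine Integrable.mono' hint hmeas.aestronglyMeasurable
      ((ae_restrict_iff' measurableSet_Ioi).mpr (.of_forall fun y hy ↦ ?_))
    have hy0 : 0 < y := one_pos.trans hy
    rw [hpow y hy0, Real.norm_of_nonneg (by positivity), sub_eq_add_neg _ M, Real.rpow_add hy0]
    gcongr ?_ * ?_
    exact Real.rpow_le_rpow_of_nonpos hy0 (by linarith) (neg_nonpos.mpr hM0)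

open scoped FourierTransform SchwartzMap in
/-- The Fourier transform of a Schwartz function on a product is a Schwartz function. -/
lemma exists_schwartzMap_eq_FT (d : ℕ) (v : SchwartzMap (SpX d × SpZ d) ℂ) :
    ∃ u : SchwartzMap (SpX d × SpZ d) ℂ, ∀ k, FT d v k = u k := by
  let e : WithLp 2 (SpX d × SpZ d) ≃L[ℝ] SpX d × SpZ d :=
    WithLp.prodContinuousLinearEquiv 2 ℝ (SpX d) (SpZ d)
  let c : ℝˣ := Units.mk0 (2 * Real.pi)⁻¹ (by positivity)
  let w : SchwartzMap (WithLp 2 (SpX d × SpZ d)) ℂ :=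
    SchwartzMap.compCLMOfContinuousLinearEquiv ℂ e v
  let s : (SpX d × SpZ d) ≃L[ℝ] WithLp 2 (SpX d × SpZ d) :=
    (ContinuousLinearEquiv.smulLeft c).trans e.symm
  refine ⟨SchwartzMap.compCLMOfContinuousLinearEquiv ℂ s (𝓕 w), fun k ↦ ?_⟩
  rw [SchwartzMap.compCLMOfContinuousLinearEquiv_apply, SchwartzMap.fourier_coe,
    Function.comp_apply, Real.fourier_eq', FT,
    ← (WithLp.volume_preserving_toLp (SpX d) (SpZ d)).integral_comp
      (MeasurableEquiv.toLp 2 (SpX d × SpZ d)).measurableEmbedding]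
  refine integral_congr_ae (.of_forall fun x ↦ ?_)
  have hs : s k = WithLp.toLp 2 ((2 * Real.pi)⁻¹ • k) := rfl
  have hw : w (WithLp.toLp 2 x) = v x := rfl
  have hinner : -2 * Real.pi * ⟪WithLp.toLp 2 x, s k⟫ = -(⟪k.1, x.1⟫ + ⟪k.2, x.2⟫) := by
    rw [hs, WithLp.prod_inner_apply]
    simp only [Prod.smul_fst, Prod.smul_snd, real_inner_smul_right]
    rw [real_inner_comm x.1, real_inner_comm x.2]
    field_simp
  simp only [hw, hinner, smul_eq_mul]
  congr 2
  push_cast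
  ring

/-- Decay of the Fourier transform of a Schwartz function separately in both variables. -/
lemma exists_norm_FT_le (d : ℕ) (v : SchwartzMap (SpX d × SpZ d) ℂ) (M N : ℕ) :
    ∃ C : ℝ, 0 ≤ C ∧ ∀ k,
      ‖FT d v k‖ ≤ C * ((1 + ‖k.1‖) ^ (-M : ℝ) * (1 + ‖k.2‖) ^ (-N : ℝ)) := by
  obtain ⟨u, hu⟩ := exists_schwartzMap_eq_FT d v
  refine ⟨2 ^ (M + N) * ((Finset.Iic (M + N, 0)).sup
    fun m ↦ SchwartzMap.seminorm ℝ m.1 m.2) u, by positivity, fun k ↦ ?_⟩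
  have h := SchwartzMap.one_add_le_sup_seminorm_apply (𝕜 := ℝ) (m := (M + N, 0)) le_rfl le_rfl u k
  rw [norm_iteratedFDeriv_zero, ← hu] at h
  have hx : 0 < 1 + ‖k.1‖ := by positivity
  have hz : 0 < 1 + ‖k.2‖ := by positivity
  rw [Real.rpow_neg hx.le, Real.rpow_neg hz.le, Real.rpow_natCast, Real.rpow_natCast,
    ← mul_inv, ← div_eq_mul_inv, le_div_iff₀ (by positivity), mul_comm]
  refine le_trans ?_ h
  rw [pow_add (1 + ‖k‖)]
  gcongr
  · exact norm_fst_le k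
  · exact norm_snd_le k

/-- For `d ∈ {1,2}`, a unit vector `n = (n_x,n_z)`, a Schwartz function `v` and
`q ∈ (0,1)`, there is `C > 0`, independent of `γ`, such that for all `γ ∈ (0,1]`,
`∫ |m_γ - m_0|·|𝓕v| dk ≤ C γ^q`. -/
theorem multiplier_difference_weighted_integral_bound (d : ℕ) (hd : d = 1 ∨ d = 2)
    (nx : SpX d) (nz : SpZ d) (hn : ‖nx‖ ^ 2 + ‖nz‖ ^ 2 = 1)
    (q : ℝ) (hq : 0 < q ∧ q < 1) (v : SchwartzMap (SpX d × SpZ d) ℂ) :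
    ∃ C > (0 : ℝ), ∀ γ : ℝ, 0 < γ → γ ≤ 1 →
      (∫⁻ k : SpX d × SpZ d,
          ENNReal.ofReal
            (|mdip d nx nz γ k - mdip d nx nz 0 k| * ‖FT d v k‖)) ≤
        ENNReal.ofReal (C * γ ^ q) := by
  have hd1 : 1 ≤ d := by omega
  have : Nonempty (Fin d) := ⟨⟨0, hd1⟩⟩
  obtain ⟨A, hA, hFT⟩ := exists_norm_FT_le d v 4 4
  have hX : Integrable (fun x : SpX d ↦ (1 + ‖x‖) ^ (-3 : ℝ)) :=
    integrable_one_add_norm (by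
      rw [finrank_euclideanSpace_fin]
      exact_mod_cast (by omega : 3 - d < 3))
  have hZ : Integrable (fun z : SpZ d ↦ ‖z‖ ^ (-q) * (1 + ‖z‖) ^ (-(4 : ℕ) : ℝ)) := by
    have h1 : (1 : ℝ) ≤ d := by exact_mod_cast hd1
    have h2 : (d : ℝ) ≤ 2 := by exact_mod_cast (by omega : d ≤ 2)
    apply integrable_norm_rpow_mul_one_add_norm_rpow <;>
      first
      | (rw [finrank_euclideanSpace_fin]; push_cast; linarith)
      | positivity
  have hint : Integrable (fun k : SpX d × SpZ d ↦
      (1 + ‖k.1‖) ^ (-3 : ℝ) * (‖k.2‖ ^ (-q) * (1 + ‖k.2‖) ^ (-(4 : ℕ) : ℝ))) :=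
    hX.mul_prod hZ
  set H : SpX d × SpZ d → ℝ := fun k ↦
    (1 + ‖k.1‖) ^ (-3 : ℝ) * (‖k.2‖ ^ (-q) * (1 + ‖k.2‖) ^ (-(4 : ℕ) : ℝ)) with hH
  have hH0 : ∀ k, 0 ≤ H k := fun k ↦ by positivity
  have hI : 0 ≤ ∫ k, H k := integral_nonneg hH0
  refine ⟨4 * A * (∫ k, H k) + 1, by positivity, fun γ hγ _ ↦ ?_⟩
  have hne : ∀ᵐ k : SpX d × SpZ d, k.2 ≠ 0 :=
    Measure.quasiMeasurePreserving_snd.ae (Measure.ae_ne volume (0 : SpZ d))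
  calc (∫⁻ k : SpX d × SpZ d,
          ENNReal.ofReal (|mdip d nx nz γ k - mdip d nx nz 0 k| * ‖FT d v k‖))
      ≤ ∫⁻ k, ENNReal.ofReal (4 * A * γ ^ q * H k) := by
        refine lintegral_mono_ae (hne.mono fun k hk ↦ ENNReal.ofReal_le_ofReal ?_)
        have hx : ‖k.1‖ ^ q * (1 + ‖k.1‖) ^ (-(4 : ℕ) : ℝ) ≤ (1 + ‖k.1‖) ^ (-3 : ℝ) := by
          have hpos : 0 < 1 + ‖k.1‖ := by positivity
          calc ‖k.1‖ ^ q * (1 + ‖k.1‖) ^ (-(4 : ℕ) : ℝ)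
              ≤ (1 + ‖k.1‖) ^ (1 : ℝ) * (1 + ‖k.1‖) ^ (-(4 : ℕ) : ℝ) := by
                gcongr
                exact (Real.rpow_le_rpow (norm_nonneg _) (by linarith) hq.1.le).trans
                  (Real.rpow_le_rpow_of_exponent_le (by linarith [norm_nonneg k.1]) hq.2.le)
            _ = (1 + ‖k.1‖) ^ (-3 : ℝ) := by
                rw [← Real.rpow_add hpos]
                norm_num
        calc |mdip d nx nz γ k - mdip d nx nz 0 k| * ‖FT d v k‖
            ≤ (4 * γ ^ q * (‖k.1‖ ^ q * ‖k.2‖ ^ (-q))) *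
                (A * ((1 + ‖k.1‖) ^ (-(4 : ℕ) : ℝ) * (1 + ‖k.2‖) ^ (-(4 : ℕ) : ℝ))) :=
              mul_le_mul (abs_mdip_sub_mdip_zero_le hn hq.1.le hq.2.le hγ.le hk) (hFT k)
                (norm_nonneg _) (by positivity)
          _ = 4 * A * γ ^ q * ((‖k.1‖ ^ q * (1 + ‖k.1‖) ^ (-(4 : ℕ) : ℝ)) *
                (‖k.2‖ ^ (-q) * (1 + ‖k.2‖) ^ (-(4 : ℕ) : ℝ))) := by ring
          _ ≤ 4 * A * γ ^ q * H k := by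
              exact mul_le_mul_of_nonneg_left (mul_le_mul_of_nonneg_right hx (by positivity))
                (by positivity)
    _ = ENNReal.ofReal (∫ k, 4 * A * γ ^ q * H k) :=
        (ofReal_integral_eq_lintegral_ofReal (hint.const_mul _)
          (.of_forall fun k ↦ mul_nonneg (by positivity) (hH0 k))).symm
    _ ≤ ENNReal.ofReal ((4 * A * (∫ k, H k) + 1) * γ ^ q) := by
        refine ENNReal.ofReal_le_ofReal ?_
        rw [integral_const_mul]
        nlinarith [Real.rpow_pos_of_pos hγ q]
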